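/- Let X be a compact metric space, f : X → X a continuous map such that P_n(f) is finite for every n ≥ 1, and suppose the generating function of the periodic point counts is rational: there exist polynomials A, B ∈ ℚ[t] with B(0) ≠ 0 such that B(t)·∑_{n≥1} p_n(f) t^{n−1} = A(t) as formal power series (this holds in particular when the logarithmic derivative of the Artin–Mazur zeta function ζ_f(t) = exp(∑_{n≥1} (p_n(f)/n) t^n) is a rational function, e.g. when ζ_f is rational). Then the period set of f is a finite, possibly empty, union of the form PS(f) = ⋃_{i=0}^{n} d_i(ℕ + k_i), i.e., there exist finitely many positive integers d_i and nonnegative integers k_i with PS(f) = ⋃_i {d_i m : m ∈ ℕ, m > k_i}. -/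

import Mathlib

/-- A power `q ^ (j / 2)` absorbs the `q`-part of `j!` for a prime `q ≥ 3`. -/
theorem factorial_dvd_ordCompl_mul_pow {q : ℕ} (hq : q.Prime) (hq3 : 3 ≤ q) {j N : ℕ}
    (hj : j ≤ N) :
    j.factorial ∣ (N.factorial / q ^ N.factorial.factorization q) * q ^ (j / 2) := by
  have := Fact.mk hq
  have h1 := Nat.ordCompl_dvd_ordCompl_of_dvd (Nat.factorial_dvd_factorial hj) q
  have h2 : j.factorial.factorization q ≤ j / 2 := by
    rw [Nat.factorization_def _ hq, Nat.le_div_iff_mul_le (by norm_num)]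
    have h3 := sub_one_mul_padicValNat_factorial (p := q) j
    have h4 : 2 * padicValNat q j.factorial ≤ (q - 1) * padicValNat q j.factorial :=
      Nat.mul_le_mul_right _ (by omega)
    omega
  calc j.factorial
      = (j.factorial / q ^ j.factorial.factorization q) * q ^ j.factorial.factorization q := by
        rw [mul_comm, Nat.ordProj_mul_ordCompl_eq_self]
    _ ∣ _ := mul_dvd_mul h1 (pow_dvd_pow q h2)

open Polynomial in
/-- An integer polynomial with `k` distinct roots whose coefficients of degree at least `k` are
divisible by `r` takes only values divisible by `r`. -/
theorem dvd_eval_of_roots (F L H : ℤ[X]) (s : Finset ℤ) (r : ℤ)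
    (hF : F = L + C r * H) (hL : L.degree < s.card) (hs : ∀ x ∈ s, F.eval x = 0) (t : ℤ) :
    r ∣ F.eval t := by
  set W : ℤ[X] := ∏ x ∈ s, (X - C x) with hW
  have hWm : W.Monic := monic_prod_of_monic _ _ fun x _ => monic_X_sub_C x
  have hWd : W.degree = s.card := by
    rw [hW, degree_prod]; simp [degree_X_sub_C, -eq_intCast]
  have hH := modByMonic_add_div H W
  have hrem : L + C r * (H %ₘ W) = 0 := by
    apply eq_zero_of_degree_lt_of_eval_finset_eq_zero s
    · refine (degree_add_le _ _).trans_lt (max_lt hL ?_)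
      rw [← smul_eq_C_mul, ← hWd]
      exact (degree_smul_le _ _).trans_lt (degree_modByMonic_lt _ hWm)
    · intro x hx
      have h0 : W.eval x = 0 := by
        rw [hW, eval_prod]; exact Finset.prod_eq_zero hx (by simp)
      have h1 := hs x hx
      rw [hF, ← hH] at h1
      simpa [h0] using h1
  have hfac : F = C r * (W * (H /ₘ W)) := by
    linear_combination hF + hrem - C r * hH
  rw [hfac, eval_mul, eval_C]
  exact dvd_mul_right _ _

open Polynomial in
/-- A `q`-adically convergent binomial series with infinitely many zeros vanishes identically. -/
theorem binomial_series_eq_zero {q : ℕ} (hq : q.Prime) (hq3 : 3 ≤ q) (c f : ℕ → ℤ)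
    (hf : ∀ n, f n = ∑ j ∈ Finset.range (n + 1), (n.choose j : ℤ) * (q : ℤ) ^ j * c j)
    (hinf : {n | f n = 0}.Infinite) (t : ℕ) : f t = 0 := by
  have hf' : ∀ N n, n ≤ N →
      f n = ∑ j ∈ Finset.range (N + 1), (n.choose j : ℤ) * (q : ℤ) ^ j * c j := by
    intro N n hn
    rw [hf]
    refine Finset.sum_subset (Finset.range_mono (by omega)) fun j _ hj => ?_
    rw [Nat.choose_eq_zero_of_lt (by simpa using hj)]; simp
  have key : ∀ h : ℕ, (q : ℤ) ^ h ∣ f t := by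
    intro h
    obtain ⟨s, hs, hcard⟩ := hinf.exists_subset_card_eq (2 * h)
    obtain ⟨N, hN⟩ : ∃ N, ∀ n ∈ insert t s, n ≤ N := ⟨_, fun n hn => Finset.le_sup (f := id) hn⟩
    set m := N.factorial / q ^ N.factorial.factorization q with hm
    have hcop : q.Coprime m := Nat.coprime_ordCompl hq (Nat.factorial_ne_zero N)
    have he : ∀ j, ∃ e : ℤ, j ≤ N → (m : ℤ) * q ^ (j / 2) = j.factorial * e := by
      intro j
      by_cases hj : j ≤ N
      · obtain ⟨e, he⟩ := factorial_dvd_ordCompl_mul_pow hq hq3 hj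
        exact ⟨e, fun _ => by exact_mod_cast he⟩
      · exact ⟨0, fun h => absurd h hj⟩
    choose e he using he
    set G : ℕ → ℤ[X] := fun j => C (e j * q ^ (j - j / 2) * c j) * descPochhammer ℤ j with hG
    set F : ℤ[X] := ∑ j ∈ Finset.range (N + 1), G j with hFdef
    have hFeval : ∀ n ≤ N, F.eval (n : ℤ) = m * f n := by
      intro n hn
      rw [hf' N n hn, hFdef, eval_finsetSum, Finset.mul_sum]
      refine Finset.sum_congr rfl fun j hj => ?_
      have hj' : j ≤ N := by simpa [Nat.lt_succ_iff] using hj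
      have hpow : (q : ℤ) ^ j = q ^ (j / 2) * q ^ (j - j / 2) := by
        rw [← pow_add]; congr 1; omega
      rw [hG]
      simp only [eval_mul, eval_C]
      rw [descPochhammer_eval_eq_descFactorial, Nat.descFactorial_eq_factorial_mul_choose,
        hpow]
      push_cast
      linear_combination (-(q : ℤ) ^ (j - j / 2) * c j * (n.choose j)) * he j hj'
    have hdvd : (q : ℤ) ^ h ∣ F.eval (t : ℤ) := by
      refine dvd_eval_of_roots F (∑ j ∈ (Finset.range (N + 1)).filter (· < 2 * h), G j)
        (∑ j ∈ (Finset.range (N + 1)).filter (¬ · < 2 * h),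
          C (e j * q ^ (j - j / 2 - h) * c j) * descPochhammer ℤ j)
        (s.map Nat.castEmbedding) _ ?_ ?_ ?_ _
      · rw [hFdef, ← Finset.sum_filter_add_sum_filter_not _ (· < 2 * h), Finset.mul_sum]
        congr 1
        refine Finset.sum_congr rfl fun j hj => ?_
        have hj' : ¬ j < 2 * h := (Finset.mem_filter.1 hj).2
        have hpow : (q : ℤ) ^ (j - j / 2) = q ^ h * q ^ (j - j / 2 - h) := by
          rw [← pow_add]; congr 1; omega
        rw [hG]
        simp only [hpow, C_mul]
        ring
      · rw [Finset.card_map, hcard, ← mem_degreeLT]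
        refine Submodule.sum_mem _ fun j hj => ?_
        rw [mem_degreeLT, hG]
        simp only [← smul_eq_C_mul]
        refine (degree_smul_le _ _).trans_lt (degree_le_natDegree.trans_lt ?_)
        rw [descPochhammer_natDegree]
        exact_mod_cast (Finset.mem_filter.1 hj).2
      · intro x hx
        obtain ⟨n, hn, rfl⟩ := Finset.mem_map.1 hx
        have h0 : f n = 0 := hs hn
        have := hFeval n (hN n (Finset.mem_insert_of_mem hn))
        rw [h0, mul_zero] at this
        exact this
    rw [hFeval t (hN t (Finset.mem_insert_self _ _))] at hdvd
    refine IsCoprime.dvd_of_dvd_mul_left ?_ hdvd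
    exact (Nat.isCoprime_iff_coprime.2 hcop).pow_left
  refine Int.eq_zero_of_abs_lt_dvd (key (f t).natAbs) ?_
  rw [Int.abs_eq_natAbs]
  exact_mod_cast Nat.lt_pow_self hq.one_lt

open Polynomial in
/-- A polynomial over a finite field with nonzero constant term divides some `X ^ M - 1`. -/
theorem exists_dvd_X_pow_sub_one {K : Type*} [Field K] [Finite K] (P : K[X])
    (hP : P.coeff 0 ≠ 0) : ∃ M : ℕ, 0 < M ∧ P ∣ X ^ M - 1 := by
  have hP0 : P ≠ 0 := by rintro rfl; simp at hP
  have : Module.Finite K (AdjoinRoot P) := (AdjoinRoot.powerBasis hP0).finite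
  have : Finite (AdjoinRoot P) := Module.finite_of_finite K
  obtain ⟨i, j, hij, h⟩ := Finite.exists_ne_map_eq_of_infinite
    fun n : ℕ => (AdjoinRoot.mk P (X ^ n))
  wlog hlt : i < j generalizing i j
  · exact this j i hij.symm h.symm (by omega)
  refine ⟨j - i, by omega, ?_⟩
  have hdvd : P ∣ X ^ i * (X ^ (j - i) - 1) := by
    have h1 := AdjoinRoot.mk_eq_mk.1 h.symm
    rwa [mul_sub, mul_one, ← pow_add, Nat.add_sub_cancel' hlt.le]
  refine IsCoprime.dvd_of_dvd_mul_left ?_ hdvd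
  refine IsCoprime.pow_right ?_
  refine ((prime_X.irreducible.coprime_iff_not_dvd).2 ?_).symm
  rwa [X_dvd_iff]

open Polynomial in
theorem exists_X_pow_sub_one_eq {q : ℕ} (hq : q.Prime) (P : ℤ[X]) (hP : ¬ (q : ℤ) ∣ P.coeff 0) :
    ∃ M : ℕ, 0 < M ∧ ∃ Q B : ℤ[X], X ^ M = Q * P + (1 + C (q : ℤ) * B) := by
  have := Fact.mk hq
  obtain ⟨M, hM, Q', hQ'⟩ := exists_dvd_X_pow_sub_one (P.map (Int.castRingHom (ZMod q)))
    (by simpa [ZMod.intCast_zmod_eq_zero_iff_dvd] using hP)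
  obtain ⟨Q, rfl⟩ := map_surjective (Int.castRingHom (ZMod q)) (ZMod.ringHom_surjective _) Q'
  obtain ⟨B, hB⟩ : C (q : ℤ) ∣ X ^ M - 1 - Q * P := by
    rw [C_dvd_iff_dvd_coeff]
    intro i
    rw [← ZMod.intCast_zmod_eq_zero_iff_dvd, ← eq_intCast (Int.castRingHom (ZMod q)),
      ← coeff_map]
    simp [hQ', mul_comm]
  exact ⟨M, hM, Q, B, by linear_combination hB⟩

/-- The shift operator on integer sequences. -/
def seqShift : Module.End ℤ (ℕ → ℤ) where
  toFun u n := u (n + 1)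
  map_add' _ _ := rfl
  map_smul' _ _ := rfl

theorem seqShift_pow_apply (k : ℕ) (u : ℕ → ℤ) (n : ℕ) : (seqShift ^ k) u n = u (n + k) := by
  induction k generalizing n with
  | zero => rfl
  | succ k ih =>
    rw [pow_succ', Module.End.mul_apply]
    change (seqShift ^ k) u (n + 1) = _
    rw [ih, Nat.add_right_comm, Nat.add_assoc]

open Polynomial in
/-- The Skolem–Mahler–Lech theorem for integer linear recurrences. -/
theorem skolem_mahler_lech (u : ℕ → ℤ) (P : ℤ[X]) (hP : P.coeff 0 ≠ 0)
    (hu : aeval seqShift P u = 0) :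
    ∃ M : ℕ, 0 < M ∧ ∀ a, {n | u (a + M * n) = 0}.Infinite → ∀ n, u (a + M * n) = 0 := by
  obtain ⟨q, hqge, hq⟩ := Nat.exists_infinite_primes ((P.coeff 0).natAbs + 3)
  have hnd : ¬ (q : ℤ) ∣ P.coeff 0 := by
    intro h
    have := Nat.le_of_dvd (Int.natAbs_pos.2 hP) (Int.natCast_dvd.1 h)
    omega
  obtain ⟨M, hM, Q, B, hQB⟩ := exists_X_pow_sub_one_eq hq P hnd
  refine ⟨M, hM, fun a hinf => ?_⟩
  have hpow : ∀ n, ∃ R : ℤ[X], X ^ (M * n) = R * P + (1 + C (q : ℤ) * B) ^ n := by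
    intro n
    have h1 : P ∣ X ^ (M * n) - (1 + C (q : ℤ) * B) ^ n := by
      rw [pow_mul]
      exact (Dvd.intro_left Q (by linear_combination -hQB)).trans (sub_dvd_pow_sub_pow _ _ n)
    obtain ⟨R, hR⟩ := h1
    exact ⟨R, by linear_combination hR⟩
  refine binomial_series_eq_zero hq (by omega) (fun j => (aeval seqShift B ^ j) u a) _ (fun n => ?_) hinf
  obtain ⟨R, hR⟩ := hpow n
  have hbin : (1 + C (q : ℤ) * B) ^ n =
      ∑ j ∈ Finset.range (n + 1), ((n.choose j : ℤ) * (q : ℤ) ^ j) • B ^ j := by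
    rw [add_comm, add_pow]
    refine Finset.sum_congr rfl fun j _ => ?_
    simp only [smul_eq_C_mul, one_pow, mul_pow, map_mul, map_pow, map_natCast]
    ring
  have h2 := congrArg (fun p => aeval seqShift p u a) hR
  simp only [hbin, map_add, map_pow, map_mul, map_sum, map_smul, aeval_X, LinearMap.add_apply,
    Module.End.mul_apply, hu, map_zero, zero_add, seqShift_pow_apply, LinearMap.sum_apply,
    Finset.sum_apply, LinearMap.smul_apply, Pi.smul_apply, smul_eq_mul] at h2
  exact h2

open Polynomial in
/-- A sequence of integers with rational generating function eventually satisfies a linear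
recurrence whose characteristic polynomial has nonzero constant term. -/
theorem exists_recurrence_of_rational (u : ℕ → ℤ) (A B : ℚ[X]) (hB0 : B.coeff 0 ≠ 0)
    (hAB : (B : PowerSeries ℚ) * PowerSeries.mk (fun n => (u n : ℚ)) = (A : PowerSeries ℚ)) :
    ∃ (K : ℕ) (P : ℤ[X]), P.coeff 0 ≠ 0 ∧ aeval seqShift P (fun n => u (K + n)) = 0 := by
  obtain ⟨b, hb, hB'⟩ := IsLocalization.integerNormalization_spec (nonZeroDivisors ℤ) B
  set B' := IsLocalization.integerNormalization (nonZeroDivisors ℤ) B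
  have hb0 : b ≠ 0 := nonZeroDivisors.ne_zero hb
  have hcoeff : ∀ i, (B'.coeff i : ℚ) = b * B.coeff i := by
    intro i
    simpa using congrArg (fun p => p.coeff i) hB'
  have hB'0 : B' ≠ 0 := by
    intro h
    have := hcoeff 0
    simp [h, hb0, hB0] at this
  refine ⟨A.natDegree + 1, B'.reverse, by simpa using hB'0, ?_⟩
  set K := A.natDegree + 1
  set r := B'.natDegree
  funext n
  rw [aeval_eq_sum_range' (Nat.lt_succ_of_le (reverse_natDegree_le B'))]
  simp only [LinearMap.sum_apply, Finset.sum_apply, LinearMap.smul_apply, Pi.smul_apply,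
    seqShift_pow_apply, smul_eq_mul, Pi.zero_apply]
  have h1 := congrArg (PowerSeries.coeff (K + n + r)) hAB
  rw [PowerSeries.coeff_mul, Finset.Nat.sum_antidiagonal_eq_sum_range_succ
    (fun i j => PowerSeries.coeff i (B : PowerSeries ℚ) *
      PowerSeries.coeff j (PowerSeries.mk (fun n => (u n : ℚ)))), coeff_coe,
    coeff_eq_zero_of_natDegree_lt (show A.natDegree < K + n + r by omega)] at h1
  simp only [coeff_coe, PowerSeries.coeff_mk] at h1
  have h2 : ∑ i ∈ Finset.range (r + 1), (B'.coeff i : ℚ) * u (K + n + r - i) = 0 := by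
    rw [Finset.sum_subset (Finset.range_mono (show r + 1 ≤ (K + n + r).succ by omega))]
    · simp only [hcoeff, mul_assoc]
      rw [← Finset.mul_sum, h1, mul_zero]
    · intro i _ hi
      rw [coeff_eq_zero_of_natDegree_lt (by simpa using hi)]
      simp
  rw [← Finset.sum_range_reflect] at h2
  have h3 : ∑ i ∈ Finset.range (r + 1), B'.reverse.coeff i * u (K + (n + i)) = 0 := by
    rw [← Int.cast_inj (α := ℚ), Int.cast_zero, ← h2, Int.cast_sum]
    refine Finset.sum_congr rfl fun i hi => ?_
    have hi' : i ≤ r := by simpa [Nat.lt_succ_iff] using hi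
    rw [coeff_reverse, revAt_le hi', show r + 1 - 1 - i = r - i by omega,
      show K + n + r - (r - i) = K + (n + i) by omega]
    push_cast
    rfl
  exact h3

/-- The zero set of an integer sequence with rational generating function is eventually
periodic. -/
theorem eventually_periodic_zeros (u : ℕ → ℤ) (A B : Polynomial ℚ) (hB0 : B.coeff 0 ≠ 0)
    (hAB : (B : PowerSeries ℚ) * PowerSeries.mk (fun n => (u n : ℚ)) = (A : PowerSeries ℚ)) :
    ∃ M N : ℕ, 0 < M ∧
      ∀ n m, N ≤ n → N ≤ m → n ≡ m [MOD M] → u n = 0 → u m = 0 := by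
  obtain ⟨K, P, hP, hu⟩ := exists_recurrence_of_rational u A B hB0 hAB
  obtain ⟨M, hM, h⟩ := skolem_mahler_lech _ P hP hu
  have hclass : ∀ a, ∃ N, ∀ n m, N ≤ n → u (K + (a + M * n)) = 0 → u (K + (a + M * m)) = 0 := by
    intro a
    by_cases hinf : {n | u (K + (a + M * n)) = 0}.Infinite
    · exact ⟨0, fun _ m _ _ => h a hinf m⟩
    · obtain ⟨N, hN⟩ := (Set.not_infinite.1 hinf).bddAbove
      refine ⟨N + 1, fun n m hn h0 => ?_⟩
      have : n ≤ N := hN h0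
      omega
  choose N hN using hclass
  refine ⟨M, K + M * (Finset.range M).sup N, hM, fun n m hn hm hnm h0 => ?_⟩
  have hle : N ((n - K) % M) ≤ (Finset.range M).sup N :=
    Finset.le_sup (Finset.mem_range.2 (Nat.mod_lt _ hM))
  have hmod : (n - K) % M = (m - K) % M := by
    refine Nat.ModEq.add_left_cancel' K ?_
    rwa [Nat.add_sub_cancel' (by omega), Nat.add_sub_cancel' (by omega)]
  have hdn : K + ((n - K) % M + M * ((n - K) / M)) = n := by
    rw [Nat.mod_add_div]; omega
  have hdm : K + ((n - K) % M + M * ((m - K) / M)) = m := by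
    rw [hmod, Nat.mod_add_div]; omega
  rw [← hdm]
  refine hN _ ((n - K) / M) _ (hle.trans ?_) (by rwa [hdn])
  rw [Nat.le_div_iff_mul_le hM, mul_comm]
  omega

theorem exists_pos_mul_modEq_gcd (n M : ℕ) (hM : 0 < M) :
    ∃ l, 0 < l ∧ n * l ≡ n.gcd M [MOD M] := by
  have hM' : (0 : ℤ) < M := by exact_mod_cast hM
  obtain ⟨l, hl⟩ := Int.eq_ofNat_of_zero_le (Int.emod_nonneg (n.gcdA M) hM'.ne')
  refine ⟨l + M, by omega, ?_⟩
  rw [← Int.natCast_modEq_iff, Nat.gcd_eq_gcd_ab]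
  push_cast
  have h1 : (l : ℤ) ≡ n.gcdA M [ZMOD M] := by
    rw [show (l : ℤ) = _ from hl.symm]; exact Int.mod_modEq _ _
  have h2 : (M : ℤ) ≡ 0 [ZMOD M] := by simp [Int.ModEq]
  have h3 := (h1.add h2).mul_left (n : ℤ)
  have h4 := (Int.ModEq.refl ((n : ℤ) * n.gcdA M)).add (h2.mul_right (n.gcdB M))
  rw [add_zero] at h3
  rw [zero_mul, add_zero] at h4
  exact h3.trans h4.symm

/-- An eventually periodic set of positive integers closed under positive multiples is a finite
union of sets `{d * j | k < j}`. -/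
theorem exists_finite_union_of_mul_closed (S : Set ℕ) (hpos : ∀ n ∈ S, 0 < n)
    (hmul : ∀ n ∈ S, ∀ j, 0 < j → n * j ∈ S) (M N : ℕ) (hM : 0 < M)
    (hper : ∀ n m, N ≤ n → N ≤ m → n ≡ m [MOD M] → n ∈ S → m ∈ S) :
    ∃ T : Finset (ℕ × ℕ), (∀ p ∈ T, 0 < p.1) ∧
      ∀ m, m ∈ S ↔ ∃ p ∈ T, ∃ j, p.2 < j ∧ m = p.1 * j := by
  classical
  refine ⟨((Finset.range (M * (N + 1))).filter (· ∈ S)).image (fun n => (n, 0)) ∪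
    ((Finset.range (M + 1)).filter (fun g => 0 < g ∧ ∀ j, N < j → g * j ∈ S)).image
      (fun g => (g, N)), ?_, fun m => ⟨fun hm => ?_, ?_⟩⟩
  · intro p hp
    simp only [Finset.mem_union, Finset.mem_image, Finset.mem_filter] at hp
    rcases hp with ⟨n, hn, rfl⟩ | ⟨g, hg, rfl⟩
    · exact hpos n hn.2
    · exact hg.2.1
  · by_cases hlt : m < M * (N + 1)
    · refine ⟨(m, 0), Finset.mem_union_left _ (Finset.mem_image.2
        ⟨m, Finset.mem_filter.2 ⟨Finset.mem_range.2 hlt, hm⟩, rfl⟩), 1, by simp, by simp⟩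
    · have hNm : N ≤ m := by nlinarith
      have hg : 0 < m.gcd M := Nat.gcd_pos_of_pos_right _ hM
      have hgM : m.gcd M ≤ M := Nat.gcd_le_right _ hM
      refine ⟨(m.gcd M, N), Finset.mem_union_right _ (Finset.mem_image.2
        ⟨m.gcd M, Finset.mem_filter.2 ⟨Finset.mem_range.2 (by omega), hg, fun j hj => ?_⟩, rfl⟩),
        m / m.gcd M, ?_, (Nat.mul_div_cancel' (Nat.gcd_dvd_left m M)).symm⟩
      · obtain ⟨l, hl, hmod⟩ := exists_pos_mul_modEq_gcd m M hM
        have hlj : 0 < l * j := Nat.mul_pos hl (by omega)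
        refine hper (m * (l * j)) _ (hNm.trans (Nat.le_mul_of_pos_right _ hlj))
          (hj.le.trans (Nat.le_mul_of_pos_left _ hg)) ?_ (hmul m hm _ hlj)
        rw [← mul_assoc]
        exact hmod.mul_right j
      · change N + 1 ≤ m / m.gcd M
        rw [Nat.le_div_iff_mul_le hg]
        nlinarith
  · rintro ⟨p, hp, j, hj, rfl⟩
    simp only [Finset.mem_union, Finset.mem_image, Finset.mem_filter] at hp
    rcases hp with ⟨n, hn, rfl⟩ | ⟨g, hg, rfl⟩
    · exact hmul n hn.2 j hj
    · exact hg.2.2 j hj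


/-- If the generating function `∑_{n ≥ 1} pₙ(f) t^{n-1}` of the periodic-point counts of a
continuous map on a compact metric space is rational (with rational coefficients and
nonvanishing denominator at `0`), then the period set of `f` is a finite, possibly empty,
union of sets of the form `d(ℕ + k) = {d(k+1), d(k+2), ...}`. -/
theorem periodSet_of_rational_zeta {X : Type*} [MetricSpace X] [CompactSpace X]
    (f : X → X) (hf : Continuous f)
    (hfin : ∀ n : ℕ, 0 < n → {x : X | f^[n] x = x}.Finite)
    (A B : Polynomial ℚ) (hB0 : B.coeff 0 ≠ 0)
    (hAB : (B : PowerSeries ℚ) *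
        PowerSeries.mk (fun n : ℕ => (Nat.card {x : X | f^[n + 1] x = x} : ℚ)) =
      (A : PowerSeries ℚ)) :
    ∃ (N : ℕ) (d k : Fin N → ℕ), (∀ i, 0 < d i) ∧
      {n : ℕ | 0 < n ∧ ∃ x : X, f^[n] x = x} =
        ⋃ i : Fin N, {m : ℕ | ∃ j : ℕ, k i < j ∧ m = d i * j} := by
  set S := {n : ℕ | 0 < n ∧ ∃ x : X, f^[n] x = x} with hS
  obtain ⟨M, N, hM, hper⟩ := eventually_periodic_zeros
    (fun n => (Nat.card {x : X | f^[n + 1] x = x} : ℤ)) A B hB0 (by simpa using hAB)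
  have hzero : ∀ n, (Nat.card {x : X | f^[n + 1] x = x} : ℤ) = 0 ↔ n + 1 ∉ S := by
    intro n
    rw [Nat.cast_eq_zero, Nat.card_coe_set_eq, Set.ncard_eq_zero (hfin (n + 1) n.succ_pos),
      Set.eq_empty_iff_forall_notMem]
    simp [hS]
  obtain ⟨T, hT, hST⟩ := exists_finite_union_of_mul_closed S (fun n hn => hn.1)
    (fun n hn j hj => ⟨Nat.mul_pos hn.1 hj, hn.2.imp fun x hx =>
      Function.IsPeriodicPt.mul_const hx j⟩) M (N + 1) hM (by
      intro n m hn hm hnm hnS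
      obtain ⟨n, rfl⟩ : ∃ n', n = n' + 1 := ⟨n - 1, by omega⟩
      obtain ⟨m, rfl⟩ : ∃ m', m = m' + 1 := ⟨m - 1, by omega⟩
      by_contra hmS
      exact (hzero n).1 (hper m n (by omega) (by omega)
        (Nat.ModEq.add_right_cancel' 1 hnm).symm ((hzero m).2 hmS)) hnS)
  refine ⟨T.card, fun i => (T.equivFin.symm i).1.1, fun i => (T.equivFin.symm i).1.2,
    fun i => hT _ (T.equivFin.symm i).2, ?_⟩
  ext m
  rw [hST, Set.mem_iUnion]
  constructor
  · rintro ⟨p, hp, h⟩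
    exact ⟨T.equivFin ⟨p, hp⟩, by simpa using h⟩
  · rintro ⟨i, h⟩
    exact ⟨_, (T.equivFin.symm i).2, h⟩
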